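/- Let A ∈ R^{n×n} have n distinct eigenvalues λ_i ∈ [0,1) with left eigenvectors q_i (rows of P^{-1}) and diagonalization A = P diag(λ_i) P^{-1}. Then the volume of R_∞ = {∑_{k≥0} A^k b u_k : |u_k| ≤ 1} equals 2^n |det(P)| · |∏_{1≤j_1<j_2≤n} (λ_{j_2}-λ_{j_1})/(1-λ_{j_1}λ_{j_2})| · ∏_{i=1}^n |q_i b|/(1-λ_i). -/

import Mathlib

open MeasureTheory

/-- Nested sum over strictly increasing index tuples below `N`. -/
noncomputable def nestSum : (n N : ℕ) → ((Fin n → ℕ) → ℝ) → ℝ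
  | 0, _, φ => φ Fin.elim0
  | (_ + 1), 0, _ => 0
  | (n + 1), (N + 1), φ => nestSum (n + 1) N (fun f => φ (fun i => f i + 1)) +
      nestSum n N (fun f => φ (Fin.cons 0 (fun i => f i + 1)))

theorem nestSum_congr (n N : ℕ) (φ ψ : (Fin n → ℕ) → ℝ)
    (h : ∀ f, StrictMono f → φ f = ψ f) : nestSum n N φ = nestSum n N ψ := by
  induction N generalizing n with
  | zero =>
    cases n with
    | zero => simp only [nestSum]; exact h _ (fun i => i.elim0)
    | succ n => simp only [nestSum]
  | succ N ih =>
    cases n with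
    | zero => simp only [nestSum]; exact h _ (fun i => i.elim0)
    | succ n =>
      simp only [nestSum]
      rw [ih (n + 1) _ (fun f => ψ (fun i => f i + 1)), ih n _ (fun f => ψ (Fin.cons 0 (fun i => f i + 1)))]
      · intro f hf
        apply h
        intro a b hab
        induction b using Fin.cases with
        | zero => exact absurd hab (Fin.not_lt_zero a)
        | succ b =>
          induction a using Fin.cases with
          | zero => simp
          | succ a => simpa using hf (Fin.succ_lt_succ_iff.mp hab)
      · intro f hf
        exact h _ (fun i j hij => by simpa using hf hij)

theorem nestSum_const_mul (n N : ℕ) (c : ℝ) (φ : (Fin n → ℕ) → ℝ) :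
    nestSum n N (fun f => c * φ f) = c * nestSum n N φ := by
  induction N generalizing n with
  | zero => cases n <;> simp [nestSum]
  | succ N ih =>
    cases n with
    | zero => simp only [nestSum]
    | succ n =>
      simp only [nestSum]
      rw [mul_add, ← ih, ← ih]

theorem nestSum_zero (n N : ℕ) : nestSum n N (fun _ => 0) = 0 := by
  have := nestSum_const_mul n N 0 (fun _ => 0)
  simpa using this

theorem nestSum_add (n N : ℕ) (φ ψ : (Fin n → ℕ) → ℝ) :
    nestSum n N (fun f => φ f + ψ f) = nestSum n N φ + nestSum n N ψ := by
  induction N generalizing n with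
  | zero => cases n <;> simp [nestSum]
  | succ N ih =>
    cases n with
    | zero => simp only [nestSum]
    | succ n =>
      simp only [nestSum]
      rw [ih, ih]; ring

theorem nestSum_sum {ι : Type*} (s : Finset ι) (n N : ℕ) (φ : ι → (Fin n → ℕ) → ℝ) :
    nestSum n N (fun f => ∑ i ∈ s, φ i f) = ∑ i ∈ s, nestSum n N (φ i) := by
  classical
  induction s using Finset.induction_on with
  | empty => simp [nestSum_zero]
  | insert a s ha ih =>
    simp only [Finset.sum_insert ha]
    rw [nestSum_add, ih]

theorem nestSum_nonneg (n N : ℕ) (φ : (Fin n → ℕ) → ℝ) (h : ∀ f, 0 ≤ φ f) :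
    0 ≤ nestSum n N φ := by
  induction N generalizing n with
  | zero => cases n <;> simp [nestSum, h]
  | succ N ih =>
    cases n with
    | zero => simp only [nestSum, h]
    | succ n =>
      simp only [nestSum]
      exact add_nonneg (ih _ _ fun f => h _) (ih _ _ fun f => h _)

/-- generalized Vandermonde determinant -/
noncomputable def gvd {n : ℕ} (lam : Fin n → ℝ) (f : Fin n → ℕ) : ℝ :=
  (Matrix.of (fun j i => lam i ^ f j)).det

theorem gvd_succ {n : ℕ} (lam : Fin n → ℝ) (f : Fin n → ℕ) :
    gvd lam (fun i => f i + 1) = (∏ i, lam i) * gvd lam f := by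
  unfold gvd
  rw [← Matrix.det_mul_row]
  congr 1
  ext j i
  simp [pow_succ, mul_comm]

theorem gvd_cons {n : ℕ} (lam : Fin (n + 1) → ℝ) (f : Fin n → ℕ) :
    gvd lam (Fin.cons 0 (fun i => f i + 1)) =
     ∑ p : Fin (n + 1), ((-1) ^ (p : ℕ) * ∏ k, lam (p.succAbove k)) *
        gvd (fun k => lam (p.succAbove k)) f := by
  rw [gvd, Matrix.det_succ_row_zero]
  refine Finset.sum_congr rfl fun p _ => ?_
  rw [mul_assoc _ _ (gvd _ _), ← gvd_succ]
  simp only [Matrix.of_apply, Fin.cons_zero, pow_zero, mul_one, gvd]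
  congr 1

theorem tendsto_rec (x r : ℕ → ℝ) (e R : ℝ) (he : 0 ≤ e) (he1 : e < 1)
    (hx : ∀ N, x (N + 1) = e * x N + r N) (hr : Filter.Tendsto r Filter.atTop (nhds R)) :
    Filter.Tendsto x Filter.atTop (nhds (R / (1 - e))) := by
  set L := R / (1 - e)
  have hL : L = e * L + R := by
    have : 1 - e ≠ 0 := by linarith
    simp only [L]; field_simp; ring
  -- d N = |x N - L|
  rw [Metric.tendsto_atTop] at hr ⊢
  intro ε hε
  obtain ⟨M, hM⟩ := hr (ε * (1 - e) / 2) (by have : 0 < 1 - e := by linarith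
                                             positivity)
  have h1 : ∀ k, |x (M + k) - L| ≤ e ^ k * |x M - L| + ε / 2 := by
    intro k
    induction k with
    | zero => simp; positivity
    | succ k ih =>
      have hh := hM (M + k) (by omega)
      rw [Real.dist_eq] at hh
      have : x (M + (k + 1)) - L = e * (x (M + k) - L) + (r (M + k) - R) := by
        rw [← add_assoc, hx]; linarith
      rw [this]
      calc _ ≤ |e * (x (M + k) - L)| + |r (M + k) - R| := abs_add_le _ _
        _ ≤ e * (e ^ k * |x M - L| + ε / 2) + ε * (1 - e) / 2 := by
          rw [abs_mul, abs_of_nonneg he]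
          gcongr
        _ = _ := by ring
  have h2 : Filter.Tendsto (fun k => e ^ k * |x M - L|) Filter.atTop (nhds (0 * |x M - L|)) :=
    (tendsto_pow_atTop_nhds_zero_of_lt_one he he1).mul_const _
  rw [zero_mul, Metric.tendsto_atTop] at h2
  obtain ⟨K, hK⟩ := h2 (ε / 2) (by positivity)
  refine ⟨M + K, fun N hN => ?_⟩
  obtain ⟨k, rfl⟩ : ∃ k, N = M + k := ⟨N - M, by omega⟩
  have := hK k (by omega)
  rw [Real.dist_eq] at this ⊢
  have h3 := h1 k
  rw [sub_zero] at this
  have := (abs_lt.mp this).2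
  linarith

/-- the closed form -/
noncomputable def cform {n : ℕ} (lam : Fin n → ℝ) : ℝ :=
  (∏ i : Fin n, ∏ j : Fin n,
        if i < j then (lam j - lam i) / (1 - lam i * lam j) else 1) * ∏ i, (1 / (1 - lam i))

theorem neg_one_prod {n : ℕ} (p : Fin (n + 1)) :
    ∏ k : Fin n, (if p < p.succAbove k then (1 : ℝ) else -1) = (-1) ^ (p : ℕ) := by
  have : ∀ k : Fin n, (if p < p.succAbove k then (1 : ℝ) else -1) =
      if (k : ℕ) < p then -1 else 1 := by
    intro k
    simp only [Fin.lt_succAbove_iff_le_castSucc, Fin.le_def, Fin.val_castSucc]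
    by_cases h : (k : ℕ) < p
    · rw [if_pos h, if_neg (by omega)]
    · rw [if_neg h, if_pos (by omega)]
  simp_rw [this]
  rw [Finset.prod_ite]
  simp only [Finset.prod_const, one_pow, mul_one]
  congr 1
  have := @Fin.card_filter_val_lt n p
  rw [this]
  have := p.2
  omega

theorem cform_succAbove {n : ℕ} (lam : Fin (n + 1) → ℝ) (p : Fin (n + 1)) :
    cform lam = (-1) ^ (p : ℕ) * cform (fun k => lam (p.succAbove k)) * (1 / (1 - lam p)) *
      ∏ k, ((lam (p.succAbove k) - lam p) / (1 - lam p * lam (p.succAbove k))) := by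
  unfold cform
  rw [Fin.prod_univ_succAbove _ p, Fin.prod_univ_succAbove _ p, Fin.prod_univ_succAbove _ p,
    ← neg_one_prod p]
  simp_rw [Fin.prod_univ_succAbove _ p]
  simp only [lt_irrefl, if_false, one_mul, Finset.prod_mul_distrib, Fin.succAbove_lt_succAbove_iff]
  have key : (∏ k, if p < p.succAbove k then (lam (p.succAbove k) - lam p) / (1 - lam p * lam (p.succAbove k)) else 1) *
     (∏ k, if p.succAbove k < p then (lam p - lam (p.succAbove k)) / (1 - lam (p.succAbove k) * lam p) else 1)
     = (∏ k : Fin n, (if p < p.succAbove k then (1 : ℝ) else -1)) * 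
     ∏ k, ((lam (p.succAbove k) - lam p) / (1 - lam p * lam (p.succAbove k))) := by
    rw [← Finset.prod_mul_distrib, ← Finset.prod_mul_distrib]
    refine Finset.prod_congr rfl fun k _ => ?_
    rcases lt_or_gt_of_ne (Fin.succAbove_ne p k) with h | h
    · rw [if_neg h.not_gt, if_pos h, if_neg h.not_gt, mul_comm (lam p) (lam _)]; ring
    · rw [if_neg h.not_gt, if_pos h, if_pos h]; ring
  linear_combination (∏ i : Fin n, ∏ j : Fin n, if i < j then
    (lam (p.succAbove j) - lam (p.succAbove i)) / (1 - lam (p.succAbove i) * lam (p.succAbove j)) else 1)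
    * (1 / (1 - lam p)) * (∏ i : Fin n, 1 / (1 - lam (p.succAbove i))) * key

theorem prod_erase_succAbove {n : ℕ} (i : Fin (n + 1)) (F : Fin (n + 1) → ℝ) :
    ∏ j ∈ Finset.univ.erase i, F j = ∏ k, F (i.succAbove k) := by
  rw [← Finset.compl_singleton, ← Fin.image_succAbove_univ,
    Finset.prod_image (fun a _ b _ h => Fin.succAbove_right_injective h)]

theorem lagrange_aux {n : ℕ} (lam : Fin (n + 1) → ℝ) (hinj : Function.Injective lam)
    (hpos : ∀ i, 0 < lam i) :
    1 / (∏ k, (- lam k)) + (∏ k, (1 + lam k)) / (-∏ k, (-1 - lam k)) +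
    ∑ p, (1 - lam p ^ 2) * (∏ k, (1 - lam p * lam (p.succAbove k))) /
      (lam p * ((lam p + 1) * ∏ k, (lam p - lam (p.succAbove k)))) = 0 := by
  open Polynomial in
  have hv : Function.Injective (Fin.cons 0 (Fin.cons (-1) lam : Fin (n + 2) → ℝ) : Fin (n + 3) → ℝ) := by
    rw [Fin.cons_injective_iff, Fin.cons_injective_iff]
    refine ⟨?_, ?_, hinj⟩
    · rintro ⟨k, hk⟩
      induction k using Fin.cases with
      | zero => simp at hk
      | succ k => simp at hk; linarith [hpos k]
    · rintro ⟨k, hk⟩; linarith [hpos k]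
  set v : Fin (n + 3) → ℝ := Fin.cons 0 (Fin.cons (-1) lam : Fin (n + 2) → ℝ) with hvdef
  let g : Polynomial ℝ := ∏ k, (1 - Polynomial.C (lam k) * Polynomial.X)
  have hgn : g.natDegree ≤ n + 1 := by
    refine (Polynomial.natDegree_prod_le _ _).trans ?_
    calc _ ≤ ∑ k : Fin (n + 1), 1 := by
            refine Finset.sum_le_sum fun k _ => ?_
            compute_degree
      _ = n + 1 := by simp
  have h0 : g.degree < (Finset.univ : Finset (Fin (n + 3))).card := by
    refine (Polynomial.degree_le_natDegree).trans_lt ?_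
    rw [Finset.card_fin]
    exact_mod_cast (by omega : g.natDegree < n + 3)
  have h := Lagrange.coeff_eq_sum (s := Finset.univ) (v := v) hv.injOn h0
  rw [Polynomial.coeff_eq_zero_of_natDegree_lt (by rw [Finset.card_fin]; omega)] at h
  have hg : ∀ x, g.eval x = ∏ k, (1 - lam k * x) := by
    intro x; simp [g, Polynomial.eval_prod]
  simp_rw [prod_erase_succAbove, hg] at h
  rw [Fin.sum_univ_succ, Fin.sum_univ_succ] at h
  simp only [Fin.prod_univ_succ (n := n + 1), Fin.succ_succAbove_zero, Fin.succ_succAbove_succ, hvdef, Fin.cons_zero,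
    Fin.cons_succ, Fin.zero_succAbove] at h
  rw [h, add_assoc]
  congr 1
  · simp
  congr 1
  · simp
  · refine Finset.sum_congr rfl fun p _ => ?_
    rw [Fin.prod_univ_succAbove _ p]
    simp only [sub_zero, mul_comm (lam p)]
    congr 2
    · ring
    · rw [Fin.prod_univ_succ]
      simp

theorem lagrange_id {n : ℕ} (lam : Fin (n + 1) → ℝ) (hinj : Function.Injective lam)
    (hlam : ∀ i, 0 ≤ lam i) :
    ∑ p, (∏ k, lam (p.succAbove k)) * (1 - lam p) * (∏ k, (1 - lam p * lam (p.succAbove k))) /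
      (∏ k, (lam (p.succAbove k) - lam p)) = 1 - ∏ i, lam i := by
  by_cases hz : ∃ p, lam p = 0
  · obtain ⟨p, hp⟩ := hz
    rw [Finset.sum_eq_single p, Finset.prod_eq_zero (Finset.mem_univ p) hp]
    · simp only [hp, sub_zero, zero_mul, Finset.prod_const_one, mul_one]
      refine div_self ?_
      rw [Finset.prod_ne_zero_iff]
      intro k _ h
      exact Fin.succAbove_ne p k (hinj (h.trans hp.symm))
    · intro q _ hq
      obtain ⟨k, hk⟩ := Fin.exists_succAbove_eq hq.symm
      rw [Finset.prod_eq_zero (Finset.mem_univ k) (by rw [hk, hp])]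
      simp
    · simp
  · have hpos : ∀ i, 0 < lam i := fun i => lt_of_le_of_ne (hlam i) (fun h => hz ⟨i, h.symm⟩)
    have h := lagrange_aux lam hinj hpos
    have e1 : ∏ k, (- lam k) = (-1) ^ (n + 1) * ∏ k, lam k := by
      rw [Finset.prod_neg]; simp
    have e2 : ∏ k, (-1 - lam k) = (-1) ^ (n + 1) * ∏ k, (1 + lam k) := by
      have : ∀ k, -1 - lam k = -(1 + lam k) := fun k => by ring
      simp_rw [this]
      rw [Finset.prod_neg]; simp
    have e3 : ∀ p, ∏ k, (lam p - lam (p.succAbove k)) =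
        (-1) ^ n * ∏ k, (lam (p.succAbove k) - lam p) := by
      intro p
      have : ∀ k, lam p - lam (p.succAbove k) = -(lam (p.succAbove k) - lam p) := fun k => by ring
      simp_rw [this]
      rw [Finset.prod_neg]; simp
    rw [e1, e2] at h
    have hE : (∏ k, lam k) ≠ 0 := Finset.prod_ne_zero_iff.mpr fun i _ => (hpos i).ne'
    have hE2 : (∏ k, (1 + lam k)) ≠ 0 :=
      Finset.prod_ne_zero_iff.mpr fun i _ => by have := hpos i; positivity
    have hs : ((-1 : ℝ) ^ n) * (-1) ^ n = 1 := by rw [← mul_pow]; simp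
    have hs0 : ((-1 : ℝ) ^ n) ≠ 0 := by positivity
    have hinv : ((-1 : ℝ) ^ n)⁻¹ = (-1) ^ n := inv_eq_of_mul_eq_one_left hs
    have t : ∀ p, (∏ k, lam (p.succAbove k)) * (1 - lam p) *
        (∏ k, (1 - lam p * lam (p.succAbove k))) / (∏ k, (lam (p.succAbove k) - lam p)) =
        (-1) ^ n * (∏ k, lam k) * ((1 - lam p ^ 2) * (∏ k, (1 - lam p * lam (p.succAbove k))) /
      (lam p * ((lam p + 1) * ∏ k, (lam p - lam (p.succAbove k))))) := by
      intro p
      have hD : ∏ k, (lam (p.succAbove k) - lam p) ≠ 0 := by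
        rw [Finset.prod_ne_zero_iff]
        intro k _ h
        exact Fin.succAbove_ne p k (hinj (sub_eq_zero.mp h))
      rw [e3, Fin.prod_univ_succAbove _ p]
      have := hpos p
      have h2 : lam p + 1 ≠ 0 := by positivity
      field_simp
      ring
    simp_rw [t]
    rw [← Finset.mul_sum]
    have h' := eq_neg_of_add_eq_zero_right h
    rw [h', pow_succ]
    field_simp
    linear_combination 0 * hs

theorem cform_rec {n : ℕ} (lam : Fin (n + 1) → ℝ) (hinj : Function.Injective lam)
    (hlam : ∀ i, 0 ≤ lam i ∧ lam i < 1) :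
    ∑ p : Fin (n + 1), ((-1) ^ (p : ℕ) * ∏ k, lam (p.succAbove k)) *
        cform (fun k => lam (p.succAbove k)) = cform lam * (1 - ∏ i, lam i) := by
  rw [← lagrange_id lam hinj fun i => (hlam i).1, Finset.mul_sum]
  refine Finset.sum_congr rfl fun p _ => ?_
  rw [cform_succAbove lam p, Finset.prod_div_distrib]
  have hD : ∏ k, (lam (p.succAbove k) - lam p) ≠ 0 := by
    rw [Finset.prod_ne_zero_iff]
    intro k _ h
    exact Fin.succAbove_ne p k (hinj (sub_eq_zero.mp h))
  have hD2 : ∏ k, (1 - lam p * lam (p.succAbove k)) ≠ 0 := by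
    rw [Finset.prod_ne_zero_iff]
    intro k _
    have h1 := hlam p
    have h2 := hlam (p.succAbove k)
    nlinarith
  have h3 : 1 - lam p ≠ 0 := by have := hlam p; linarith
  field_simp

theorem nestSum_tendsto {n : ℕ} (lam : Fin n → ℝ) (hinj : Function.Injective lam)
    (hlam : ∀ i, 0 ≤ lam i ∧ lam i < 1) :
    Filter.Tendsto (fun N => nestSum n N (gvd lam)) Filter.atTop (nhds (cform lam)) := by
  induction n with
  | zero =>
    simp [nestSum, gvd, cform]
  | succ n ih =>
    have h1 : cform lam = (cform lam * (1 - ∏ i, lam i)) / (1 - ∏ i, lam i) := by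
      have : ∏ i, lam i < 1 := by
        rw [Fin.prod_univ_succ]
        have : ∏ i : Fin n, lam i.succ ≤ 1 :=
          Finset.prod_le_one (fun i _ => (hlam _).1) (fun i _ => (hlam _).2.le)
        have h2 := hlam 0
        nlinarith
      have : 1 - ∏ i, lam i ≠ 0 := by linarith
      field_simp
    rw [h1, ← cform_rec lam hinj hlam]
    refine tendsto_rec _ (fun N => ∑ p : Fin (n + 1), ((-1) ^ (p : ℕ) * ∏ k, lam (p.succAbove k)) *
        nestSum n N (gvd (fun k => lam (p.succAbove k)))) _ _
        (Finset.prod_nonneg fun i _ => (hlam i).1) ?_ ?_ ?_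
    · rw [Fin.prod_univ_succ]
      have : ∏ i : Fin n, lam i.succ ≤ 1 :=
        Finset.prod_le_one (fun i _ => (hlam _).1) (fun i _ => (hlam _).2.le)
      have h2 := hlam 0
      nlinarith
    · intro N
      simp only [nestSum, gvd_succ, gvd_cons, nestSum_const_mul, nestSum_sum]
    · refine tendsto_finsetSum _ fun p _ => Filter.Tendsto.const_mul _ (ih _ ?_ ?_)
      · exact hinj.comp Fin.succAbove_right_injective
      · exact fun i => hlam _

theorem signVar_lt_card (P : Polynomial ℝ) (hP : P ≠ 0) : P.signVariations + 1 ≤ P.support.card := by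
  induction hc : P.support.card generalizing P with
  | zero => simp at hc; exact absurd hc hP
  | succ m ih =>
    by_cases h : P.eraseLead = 0
    · have := Polynomial.signVariations_eq_eraseLead_add_ite hP
      rw [h] at this
      simp [hP] at this
      omega
    · have h1 := ih P.eraseLead h (Polynomial.card_support_eraseLead' hc)
      have h2 := Polynomial.signVariations_le_eraseLead_succ (P := P)
      omega

/-- A nonzero polynomial has fewer distinct positive roots than monomials. -/
theorem card_pos_roots_lt (P : Polynomial ℝ) (hP : P ≠ 0) (s : Finset ℝ)
    (hs : ∀ x ∈ s, 0 < x ∧ P.eval x = 0) : s.card < P.support.card := by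
  have h1 := signVar_lt_card P hP
  have h2 := Polynomial.roots_countP_pos_le_signVariations (P := P)
  have h3 : s.card ≤ P.roots.countP (0 < ·) := by
    rw [Multiset.countP_eq_card_filter]
    have : s.val ≤ P.roots.filter (0 < ·) := by
      rw [Multiset.le_iff_subset s.nodup]
      intro x hx
      have := hs x hx
      simp [hP, this]
    simpa using Multiset.card_le_card this
  omega

theorem gvd_snoc_poly {n : ℕ} (mu : Fin n → ℝ) (f : Fin (n + 1) → ℕ) :
    ∃ c : Fin (n + 1) → ℝ, (c (Fin.last n) = gvd mu (fun k => f k.castSucc)) ∧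
      ∀ x, gvd (Fin.snoc mu x : Fin (n + 1) → ℝ) f = ∑ j, c j * x ^ f j := by
  refine ⟨fun j => (-1) ^ ((j : ℕ) + n) * gvd mu (fun k => f (j.succAbove k)), ?_, ?_⟩
  · simp [← two_mul]
  · intro x
    rw [gvd, Matrix.det_succ_column _ (Fin.last n)]
    refine Finset.sum_congr rfl fun j _ => ?_
    simp only [Matrix.of_apply, Fin.snoc_last, Fin.val_last, gvd]
    rw [mul_right_comm]
    congr 3
    ext a b
    simp

theorem gvd_pos {n : ℕ} (lam : Fin n → ℝ) (hm : StrictMono lam) (hpos : ∀ i, 0 < lam i)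
    (f : Fin n → ℕ) (hf : StrictMono f) : 0 < gvd lam f := by
  induction n with
  | zero => simp [gvd]
  | succ n ih =>
    obtain ⟨mu, y, rfl⟩ : ∃ (mu : Fin n → ℝ) (y : ℝ), lam = Fin.snoc mu y :=
      ⟨Fin.init lam, lam (Fin.last n), by simp⟩
    have hmu : StrictMono mu := by
      intro a b hab
      simpa using hm (Fin.castSucc_lt_castSucc_iff.mpr hab)
    have hmupos : ∀ i, 0 < mu i := fun i => by simpa using hpos i.castSucc
    have hy : 0 < y := by simpa using hpos (Fin.last n)
    have hmuy : ∀ i, mu i < y := fun i => by simpa using hm (Fin.castSucc_lt_last i)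
    obtain ⟨c, hc, hx⟩ := gvd_snoc_poly mu f
    have hcpos : 0 < c (Fin.last n) := by
      rw [hc]
      exact ih mu hmu hmupos _ (hf.comp Fin.strictMono_castSucc)
    let Q : Polynomial ℝ := ∑ j, Polynomial.monomial (f j) (c j)
    have hQ : ∀ x, Q.eval x = ∑ j, c j * x ^ f j := by
      intro x; simp [Q, Polynomial.eval_finsetSum]
    have hcoef : Q.coeff (f (Fin.last n)) = c (Fin.last n) := by
      simp [Q, Polynomial.finsetSum_coeff, Polynomial.coeff_monomial, hf.injective.eq_iff]
    have hQ0 : Q ≠ 0 := by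
      intro h; rw [h] at hcoef; simp at hcoef; linarith
    have hsupp : Q.support.card ≤ n + 1 := by
      have : Q.support ⊆ Finset.univ.image f := by
        intro d hd
        by_contra hcon
        rw [Polynomial.mem_support_iff] at hd
        apply hd
        simp only [Q, Polynomial.finsetSum_coeff, Polynomial.coeff_monomial]
        refine Finset.sum_eq_zero fun j _ => if_neg ?_
        rintro rfl
        exact hcon (Finset.mem_image_of_mem _ (Finset.mem_univ j))
      exact (Finset.card_le_card this).trans (Finset.card_image_le.trans (by simp))
    have hroot : ∀ i, Q.eval (mu i) = 0 := by
      intro i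
      rw [hQ, ← hx, gvd]
      refine Matrix.det_zero_of_column_eq (i := i.castSucc) (j := Fin.last n)
        (Fin.castSucc_lt_last i).ne ?_
      intro k; simp
    have hno : ∀ x, y ≤ x → Q.eval x ≠ 0 := by
      intro x hxy h0
      have hlt : ∀ i, mu i < x := fun i => (hmuy i).trans_le hxy
      have := card_pos_roots_lt Q hQ0 (insert x (Finset.univ.image mu)) (by
        intro z hz
        rw [Finset.mem_insert] at hz
        rcases hz with rfl | hz
        · exact ⟨by linarith, h0⟩
        · obtain ⟨i, _, rfl⟩ := Finset.mem_image.mp hz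
          exact ⟨hmupos i, hroot i⟩)
      rw [Finset.card_insert_of_notMem, Finset.card_image_of_injective _ hmu.injective] at this
      · simp at this; omega
      · simp only [Finset.mem_image, Finset.mem_univ, true_and, not_exists]
        intro i hi; exact (hlt i).ne hi
    have hdeg : Q.natDegree = f (Fin.last n) := by
      apply le_antisymm
      · refine Polynomial.natDegree_sum_le_of_forall_le _ _ fun j _ => ?_
        exact (Polynomial.natDegree_monomial_le _).trans (hf.monotone (Fin.le_last j))
      · exact Polynomial.le_natDegree_of_ne_zero (by rw [hcoef]; exact hcpos.ne')
    have hlead : Q.leadingCoeff = c (Fin.last n) := by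
      rw [Polynomial.leadingCoeff, hdeg, hcoef]
    rw [hx, ← hQ]
    by_contra hneg
    rw [not_lt] at hneg
    -- there is a large point with positive value
    obtain ⟨x, hxy, hxp⟩ : ∃ x, y ≤ x ∧ 0 ≤ Q.eval x := by
      by_cases hd : 0 < Q.degree
      · have := Polynomial.tendsto_atTop_of_leadingCoeff_nonneg Q hd (by rw [hlead]; exact hcpos.le)
        exact ((Filter.eventually_ge_atTop y).and (this.eventually_ge_atTop 0)).exists
      · have h1 := Polynomial.eq_C_of_degree_le_zero (not_lt.mp hd)
        refine ⟨y, le_rfl, ?_⟩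
        have : f (Fin.last n) = 0 := by
          rw [← hdeg]; exact Polynomial.natDegree_eq_zero_iff_degree_le_zero.mpr (not_lt.mp hd)
        rw [h1, Polynomial.eval_C]
        rw [this] at hcoef
        rw [hcoef]; exact hcpos.le
    obtain ⟨z, hz, hz0⟩ := intermediate_value_Icc hxy (Q.continuous.continuousOn)
      (show (0 : ℝ) ∈ Set.Icc _ _ from ⟨hneg, hxp⟩)
    exact hno z hz.1 hz0

theorem gvd_nonneg {n : ℕ} (lam : Fin n → ℝ) (hm : StrictMono lam) (hpos : ∀ i, 0 ≤ lam i)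
    (f : Fin n → ℕ) (hf : StrictMono f) : 0 ≤ gvd lam f := by
  have hcont : Continuous (fun ε : ℝ => gvd (fun i => lam i + ε) f) := by
    unfold gvd
    refine Continuous.matrix_det ?_
    fun_prop
  have ht := (hcont.tendsto 0).mono_left (nhdsWithin_le_nhds (s := Set.Ioi 0))
  simp only [add_zero] at ht
  refine ge_of_tendsto ht ?_
  filter_upwards [self_mem_nhdsWithin] with ε hε
  rw [Set.mem_Ioi] at hε
  exact (gvd_pos _ (fun a b hab => by have := hm hab; linarith)
    (fun i => by have := hpos i; linarith) f hf).le

/-- All generalized Vandermonde determinants have a common sign. -/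
theorem gvd_sign {n : ℕ} (lam : Fin n → ℝ) (hinj : Function.Injective lam) (hpos : ∀ i, 0 ≤ lam i) :
    ∃ s : ℝ, |s| = 1 ∧ ∀ f : Fin n → ℕ, StrictMono f → |gvd lam f| = s * gvd lam f := by
  let σ := Tuple.sort lam
  have hσ : StrictMono (lam ∘ σ) :=
    (Tuple.monotone_sort lam).strictMono_of_injective (hinj.comp σ.injective)
  have hperm : ∀ f, gvd (lam ∘ σ) f = (Equiv.Perm.sign σ : ℝ) * gvd lam f := by
    intro f
    rw [gvd, gvd]
    have := Matrix.det_permute' σ (Matrix.of (fun j i => lam i ^ f j))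
    rw [← this]
    rfl
  have hs : |((Equiv.Perm.sign σ : ℤˣ) : ℝ)| = 1 := by
    rcases Int.units_eq_one_or (Equiv.Perm.sign σ) with h | h <;> simp [h]
  refine ⟨(Equiv.Perm.sign σ : ℝ), hs, fun f hf => ?_⟩
  have := gvd_nonneg _ hσ (fun i => hpos _) f hf
  rw [hperm] at this
  rw [← abs_of_nonneg this, abs_mul, hs, one_mul]

/-- zonotope -/
def zono {n : ℕ} (N : ℕ) (v : ℕ → Fin n → ℝ) : Set (Fin n → ℝ) :=
  (fun u : ℕ → ℝ => ∑ k ∈ Finset.range N, u k • v k) '' {u | ∀ k, |u k| ≤ 1}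

theorem box_compact : IsCompact {u : ℕ → ℝ | ∀ k, |u k| ≤ 1} := by
  have : {u : ℕ → ℝ | ∀ k, |u k| ≤ 1} = Set.pi Set.univ (fun _ => Set.Icc (-1) 1) := by
    ext u; simp only [Set.mem_univ_pi, Set.mem_Icc, ← abs_le]; rfl
  rw [this]
  exact isCompact_univ_pi fun _ => isCompact_Icc

theorem box_convex : Convex ℝ {u : ℕ → ℝ | ∀ k, |u k| ≤ 1} := by
  have : {u : ℕ → ℝ | ∀ k, |u k| ≤ 1} = Set.pi Set.univ (fun _ => Set.Icc (-1) 1) := by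
    ext u; simp only [Set.mem_univ_pi, Set.mem_Icc, ← abs_le]; rfl
  rw [this]
  exact convex_pi fun _ _ => convex_Icc _ _

theorem zono_compact {n : ℕ} (N : ℕ) (v : ℕ → Fin n → ℝ) : IsCompact (zono N v) :=
  box_compact.image (by fun_prop)

theorem zono_convex {n : ℕ} (N : ℕ) (v : ℕ → Fin n → ℝ) : Convex ℝ (zono N v) := by
  refine box_convex.is_linear_image ⟨?_, ?_⟩
  · intro x y; simp [add_smul, Finset.sum_add_distrib]
  · intro c x; simp [Finset.smul_sum, smul_smul]

theorem zono_nonempty {n : ℕ} (N : ℕ) (v : ℕ → Fin n → ℝ) : (zono N v).Nonempty :=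
  ⟨_, 0, by simp, rfl⟩

theorem zono_image {n m : ℕ} (N : ℕ) (v : ℕ → Fin n → ℝ) (T : (Fin n → ℝ) →ₗ[ℝ] (Fin m → ℝ)) :
    zono N (fun k => T (v k)) = T '' zono N v := by
  unfold zono
  rw [Set.image_image]
  simp

theorem zono_succ {n : ℕ} (N : ℕ) (v : ℕ → Fin n → ℝ) :
    zono (N + 1) v = {x | ∃ t : ℝ, |t| ≤ 1 ∧ x - t • v 0 ∈ zono N (fun k => v (k + 1))} := by
  ext x
  constructor
  · rintro ⟨u, hu, rfl⟩
    refine ⟨u 0, hu 0, fun k => u (k + 1), fun k => hu _, ?_⟩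
    simp [Finset.sum_range_succ']
  · rintro ⟨t, ht, u, hu, h⟩
    refine ⟨fun k => Nat.casesOn k t u, ?_, ?_⟩
    · rintro (_ | k)
      · exact ht
      · exact hu k
    · simp only [Finset.sum_range_succ'] at h ⊢
      rw [h]; simp

theorem vol_interval (I : Set ℝ) (hc : IsCompact I) (hconv : Convex ℝ I) (hne : I.Nonempty) :
    volume {s : ℝ | ∃ t : ℝ, |t| ≤ 1 ∧ s - t ∈ I} = volume I + 2 := by
  have h := eq_Icc_of_connected_compact ⟨hne, hconv.isPreconnected⟩ hc
  generalize sInf I = a at h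
  generalize sSup I = b at h
  subst h
  have hab : a ≤ b := Set.nonempty_Icc.mp hne
  have : {s : ℝ | ∃ t : ℝ, |t| ≤ 1 ∧ s - t ∈ Set.Icc a b} = Set.Icc (a - 1) (b + 1) := by
    ext s
    simp only [Set.mem_ofPred_eq, Set.mem_Icc, abs_le]
    constructor
    · rintro ⟨t, ⟨h1, h2⟩, h3, h4⟩
      constructor <;> linarith
    · rintro ⟨h1, h2⟩
      rcases le_total s a with h | h
      · exact ⟨s - a, ⟨by linarith, by linarith⟩, by linarith, by linarith⟩
      · rcases le_total s b with h' | h'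
        · exact ⟨0, ⟨by linarith, by linarith⟩, by linarith, by linarith⟩
        · exact ⟨s - b, ⟨by linarith, by linarith⟩, by linarith, by linarith⟩
  rw [this, Real.volume_Icc, Real.volume_Icc, show (2 : ENNReal) = ENNReal.ofReal 2 by simp,
    ← ENNReal.ofReal_add (by linarith) (by norm_num)]
  congr 1; ring

theorem vol_fubini {n : ℕ} (K : Set (Fin (n + 1) → ℝ)) (hK : MeasurableSet K) :
    volume K = ∫⁻ y : Fin n → ℝ, volume {s : ℝ | (Fin.cons s y : Fin (n + 1) → ℝ) ∈ K} := by
  have hmp := volume_preserving_piFinSuccAbove (fun _ : Fin (n + 1) => ℝ) 0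
  have h1 := (hmp.symm).measure_preimage hK.nullMeasurableSet
  rw [← h1, Measure.volume_eq_prod, Measure.prod_apply_symm]
  · refine lintegral_congr fun y => ?_
    congr 1
    ext s
    change (Fin.insertNth 0 s y : Fin (n + 1) → ℝ) ∈ K ↔ (Fin.cons s y : Fin (n + 1) → ℝ) ∈ K
    rw [Fin.insertNth_zero']
  · exact (MeasurableEquiv.measurable _) hK

theorem vol_segment {n : ℕ} (K : Set (Fin (n + 1) → ℝ)) (hc : IsCompact K) (hconv : Convex ℝ K) :
    volume {x | ∃ t : ℝ, |t| ≤ 1 ∧ x - t • (Pi.single 0 1 : Fin (n + 1) → ℝ) ∈ K} =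
      volume K + 2 * volume (Fin.tail '' K : Set (Fin n → ℝ)) := by
  have htail : Continuous (Fin.tail : (Fin (n + 1) → ℝ) → (Fin n → ℝ)) := by
    unfold Fin.tail; fun_prop
  have hproj : MeasurableSet (Fin.tail '' K : Set (Fin n → ℝ)) :=
    (hc.image htail).measurableSet
  have hK' : IsCompact {x | ∃ t : ℝ, |t| ≤ 1 ∧ x - t • (Pi.single 0 1 : Fin (n + 1) → ℝ) ∈ K} := by
    have : {x | ∃ t : ℝ, |t| ≤ 1 ∧ x - t • (Pi.single 0 1 : Fin (n + 1) → ℝ) ∈ K} =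
        (fun p : ℝ × (Fin (n + 1) → ℝ) => p.1 • (Pi.single 0 1 : Fin (n + 1) → ℝ) + p.2) ''
          (Set.Icc (-1) 1 ×ˢ K) := by
      ext x
      constructor
      · rintro ⟨t, ht, hx⟩
        exact ⟨(t, _), ⟨abs_le.mp ht, hx⟩, by simp⟩
      · rintro ⟨⟨t, y⟩, ⟨ht, hy⟩, rfl⟩
        exact ⟨t, abs_le.mpr ht, by simpa using hy⟩
    rw [this]
    exact (isCompact_Icc.prod hc).image (by fun_prop)
  have hcons : ∀ y : Fin n → ℝ, Continuous (fun s : ℝ => (Fin.cons s y : Fin (n + 1) → ℝ)) := by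
    intro y
    refine continuous_pi fun i => ?_
    refine Fin.cases ?_ (fun j => ?_) i
    · simp only [Fin.cons_zero]; exact continuous_id
    · simp only [Fin.cons_succ]; exact continuous_const
  rw [vol_fubini _ hK'.measurableSet, vol_fubini K hc.measurableSet,
    ← lintegral_indicator_one hproj, ← lintegral_const_mul _ (by
      exact measurable_one.indicator hproj),
    ← lintegral_add_right _ (by exact (measurable_one.indicator hproj).const_mul _)]
  refine lintegral_congr fun y => ?_
  have hfib : {s : ℝ | (Fin.cons s y : Fin (n + 1) → ℝ) ∈
      {x | ∃ t : ℝ, |t| ≤ 1 ∧ x - t • (Pi.single 0 1 : Fin (n + 1) → ℝ) ∈ K}} =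
      {s : ℝ | ∃ t : ℝ, |t| ≤ 1 ∧ s - t ∈ {s : ℝ | (Fin.cons s y : Fin (n + 1) → ℝ) ∈ K}} := by
    ext s
    simp only [Set.mem_ofPred_eq]
    have : ∀ t : ℝ, (Fin.cons s y : Fin (n + 1) → ℝ) - t • (Pi.single 0 1 : Fin (n + 1) → ℝ) =
        Fin.cons (s - t) y := by
      intro t
      ext i
      refine Fin.cases ?_ (fun j => ?_) i <;> simp
    simp_rw [this]
  rw [hfib]
  by_cases hy : y ∈ (Fin.tail '' K : Set (Fin n → ℝ))
  · rw [vol_interval]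
    · simp [hy]
    · have hcl : IsClosed {s : ℝ | (Fin.cons s y : Fin (n + 1) → ℝ) ∈ K} :=
        hc.isClosed.preimage (hcons y)
      refine (hc.image (continuous_apply 0)).of_isClosed_subset hcl ?_
      intro s hs
      exact ⟨_, hs, by simp⟩
    · intro a ha b hb p q hp hq hpq
      have := hconv ha hb hp hq hpq
      simp only [Set.mem_ofPred_eq]
      convert this using 1
      ext i
      refine Fin.cases ?_ (fun j => ?_) i
      · simp
      · simp [← add_mul, hpq]
    · obtain ⟨x, hx, rfl⟩ := hy
      exact ⟨x 0, by simpa using hx⟩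
  · have hempty : {s : ℝ | (Fin.cons s y : Fin (n + 1) → ℝ) ∈ K} = ∅ := by
      ext s
      simp only [Set.mem_ofPred_eq, Set.mem_empty_iff_false, iff_false]
      intro hs
      exact hy ⟨_, hs, by simp⟩
    rw [hempty]
    simp [hy]

theorem vol_zono {n : ℕ} (N : ℕ) (v : ℕ → Fin n → ℝ) :
    volume (zono N v) = ENNReal.ofReal (2 ^ n *
      nestSum n N (fun f => |(Matrix.of (fun j => v (f j))).det|)) := by
  induction N generalizing n with
  | zero =>
    cases n with
    | zero =>
      have : zono 0 v = Set.univ := Set.Nonempty.eq_univ (zono_nonempty _ _)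
      rw [this, volume_pi, Measure.pi_of_empty]; simp [nestSum]
    | succ n =>
      have : zono 0 v = {0} := by
        unfold zono
        simp only [Finset.range_zero, Finset.sum_empty]
        exact Set.Nonempty.image_const ⟨0, by simp⟩ _
      rw [this]; simp [nestSum]
  | succ N ih =>
    cases n with
    | zero =>
      have : zono (N + 1) v = Set.univ := Set.Nonempty.eq_univ (zono_nonempty _ _)
      rw [this, volume_pi, Measure.pi_of_empty]; simp [nestSum]
    | succ n =>
      by_cases hv : v 0 = 0
      · have h1 : zono (N + 1) v = zono N (fun k => v (k + 1)) := by
          rw [zono_succ]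
          ext x
          simp only [hv, smul_zero, sub_zero, Set.mem_ofPred_eq]
          exact ⟨fun ⟨_, _, h⟩ => h, fun h => ⟨0, by simp, h⟩⟩
        rw [h1, ih]
        congr 2
        simp only [nestSum]
        have : ∀ f : Fin n → ℕ, |(Matrix.of (fun j : Fin (n + 1) =>
            v ((Fin.cons 0 (fun i => f i + 1) : Fin (n + 1) → ℕ) j))).det| = 0 := by
          intro f
          rw [Matrix.det_eq_zero_of_row_eq_zero 0 (by simp [hv]), abs_zero]
        simp_rw [this]
        rw [nestSum_zero, add_zero]
      · obtain ⟨T, hT⟩ := SeparatingDual.exists_continuousLinearEquiv_apply_eq (R := ℝ)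
          (x := (Pi.single 0 1 : Fin (n + 1) → ℝ)) (y := v 0) (by simp) hv
        let T' : (Fin (n + 1) → ℝ) →ₗ[ℝ] (Fin (n + 1) → ℝ) := T.toLinearEquiv.toLinearMap
        obtain ⟨w, rfl⟩ : ∃ w : ℕ → Fin (n + 1) → ℝ, v = fun k => T' (w k) :=
          ⟨fun k => T.symm (v k), by ext k; simp [T']⟩
        have hw : w 0 = Pi.single 0 1 := T.injective hT.symm
        have hdet : ∀ f : Fin (n + 1) → ℕ, |(Matrix.of (fun j => T' (w (f j)))).det| =
            |LinearMap.det T'| * |(Matrix.of (fun j => w (f j))).det| := by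
          intro f
          rw [← abs_mul, mul_comm, ← LinearMap.det_toMatrix', ← Matrix.det_transpose (LinearMap.toMatrix' T'),
            ← Matrix.det_mul]
          congr 2
          ext j i
          have : T' (w (f j)) = (LinearMap.toMatrix' T').mulVec (w (f j)) := by
            rw [LinearMap.toMatrix'_mulVec]
          rw [Matrix.of_apply, this]
          simp [Matrix.mul_apply, Matrix.mulVec, dotProduct, mul_comm]
        have htl : (Fin.tail '' zono N (fun k => w (k + 1)) : Set (Fin n → ℝ)) =
            zono N (fun k => Fin.tail (w (k + 1))) :=
          (zono_image N (fun k => w (k + 1)) (LinearMap.funLeft ℝ ℝ Fin.succ)).symm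
        rw [zono_image, Measure.addHaar_image_linearMap]
        simp_rw [hdet]
        rw [nestSum_const_mul, zono_succ, hw, vol_segment _ (zono_compact _ _) (zono_convex _ _),
          htl, ih, ih]
        simp only [nestSum]
        have hlap : ∀ f : Fin n → ℕ, |(Matrix.of (fun j : Fin (n + 1) =>
            w ((Fin.cons 0 (fun i => f i + 1) : Fin (n + 1) → ℕ) j))).det| =
            |(Matrix.of (fun j => (Fin.tail (w (f j + 1)) : Fin n → ℝ))).det| := by
          intro f
          rw [Matrix.det_succ_row_zero, Finset.sum_eq_single 0]
          · simp only [Matrix.of_apply, Fin.cons_zero, hw]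
            simp
            rfl
          · intro j _ hj
            simp [hw, hj]
          · simp
        simp_rw [hlap]
        have p1 := nestSum_nonneg (n + 1) N (fun f => |(Matrix.of (fun j => w (f j + 1))).det|)
          (fun f => abs_nonneg _)
        have p2 := nestSum_nonneg n N (fun f => |(Matrix.of (fun j => (Fin.tail (w (f j + 1)) : Fin n → ℝ))).det|)
          (fun f => abs_nonneg _)
        rw [show (2 : ENNReal) = ENNReal.ofReal 2 by simp, ← ENNReal.ofReal_mul (by norm_num),
          ← ENNReal.ofReal_add (by positivity) (by positivity), ← ENNReal.ofReal_mul (by positivity)]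
        congr 1
        ring

theorem vol_reach {n : ℕ} (v : ℕ → Fin n → ℝ) (L : ℝ)
    (hL : Filter.Tendsto (fun N => nestSum n N (fun f => |(Matrix.of (fun j => v (f j))).det|))
      Filter.atTop (nhds L)) :
    volume {x : Fin n → ℝ | ∃ u : ℕ → ℝ, (∀ k, |u k| ≤ 1) ∧ HasSum (fun k : ℕ => u k • v k) x} =
      ENNReal.ofReal (2 ^ n * L) := by
  have hmono : Monotone (fun N => zono N v) := by
    refine monotone_nat_of_le_succ fun N => ?_
    rintro x ⟨u, hu, rfl⟩
    refine ⟨fun k => if k < N then u k else 0, fun k => ?_, ?_⟩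
    · dsimp only
      split_ifs
      · exact hu k
      · simp
    · simp only [Finset.sum_range_succ, lt_irrefl, if_false, zero_smul, add_zero]
      refine Finset.sum_congr rfl fun k hk => ?_
      rw [if_pos (Finset.mem_range.mp hk)]
  have hconv : Convex ℝ (⋃ N, zono N v) :=
    (hmono.directed_le).convex_iUnion fun N => zono_convex N v
  have ht := tendsto_measure_iUnion_atTop (μ := (volume : Measure (Fin n → ℝ))) hmono
  have ht2 : Filter.Tendsto (volume ∘ fun N => zono N v) Filter.atTop
      (nhds (ENNReal.ofReal (2 ^ n * L))) := by
    have : (volume ∘ fun N => zono N v) = fun N => ENNReal.ofReal (2 ^ n *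
      nestSum n N (fun f => |(Matrix.of (fun j => v (f j))).det|)) := by
      ext N; exact vol_zono N v
    rw [this]
    exact (ENNReal.continuous_ofReal.tendsto _).comp (hL.const_mul _)
  have hU := tendsto_nhds_unique ht ht2
  rw [← hU]
  apply le_antisymm
  · calc _ ≤ volume (closure (⋃ N, zono N v)) := by
            apply measure_mono
            rintro x ⟨u, hu, hx⟩
            refine mem_closure_of_tendsto hx.tendsto_sum_nat (Filter.Eventually.of_forall fun N => ?_)
            exact Set.mem_iUnion.mpr ⟨N, u, hu, rfl⟩
      _ ≤ volume ((⋃ N, zono N v) ∪ frontier (⋃ N, zono N v)) := by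
            rw [closure_eq_self_union_frontier]
      _ ≤ volume (⋃ N, zono N v) + volume (frontier (⋃ N, zono N v)) := measure_union_le _ _
      _ = _ := by rw [hconv.addHaar_frontier volume, add_zero]
  · apply measure_mono
    intro x hx
    obtain ⟨N, u, hu, rfl⟩ := Set.mem_iUnion.mp hx
    refine ⟨fun k => if k < N then u k else 0, fun k => ?_, ?_⟩
    · dsimp only
      split_ifs
      · exact hu k
      · simp
    · have : ∑ k ∈ Finset.range N, u k • v k =
          ∑ k ∈ Finset.range N, (if k < N then u k else 0) • v k :=
        Finset.sum_congr rfl fun k hk => by rw [if_pos (Finset.mem_range.mp hk)]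
      simp only [this]
      refine hasSum_sum_of_ne_finset_zero fun k hk => ?_
      rw [if_neg (by simpa using hk), zero_smul]

theorem stmt8_det {n : ℕ} (lam : Fin n → ℝ) (P A : Matrix (Fin n) (Fin n) ℝ) (hP : IsUnit P.det)
    (hA : A = P * Matrix.diagonal lam * P⁻¹) (b : Fin n → ℝ) (f : Fin n → ℕ) :
    (Matrix.of (fun j => (A ^ f j).mulVec b)).det =
      P.det * (∏ i, P⁻¹.mulVec b i) * gvd lam f := by
  have hpow : ∀ k, A ^ k = P * Matrix.diagonal (fun i => lam i ^ k) * P⁻¹ := by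
    intro k
    induction k with
    | zero =>
      simp [Matrix.mul_nonsing_inv P hP]
    | succ k ih =>
      rw [pow_succ, ih, hA]
      calc _ = P * Matrix.diagonal (fun i => lam i ^ k) * (P⁻¹ * P) * Matrix.diagonal lam * P⁻¹ := by
            simp only [Matrix.mul_assoc]
        _ = _ := by
          rw [Matrix.nonsing_inv_mul P hP, Matrix.mul_one, Matrix.mul_assoc P,
            Matrix.diagonal_mul_diagonal]
          simp [pow_succ]
  have hM : Matrix.of (fun j => (A ^ f j).mulVec b) =
      (Matrix.of (fun j i => P⁻¹.mulVec b i * (Matrix.of (fun j i => lam i ^ f j) : Matrix (Fin n) (Fin n) ℝ) j i)) * P.transpose := by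
    ext j i
    rw [Matrix.of_apply, hpow, ← Matrix.mulVec_mulVec, ← Matrix.mulVec_mulVec, Matrix.mul_apply]
    conv_lhs => rw [Matrix.mulVec, dotProduct]
    refine Finset.sum_congr rfl fun l _ => ?_
    rw [Matrix.mulVec_diagonal]
    simp only [Matrix.of_apply, Matrix.transpose_apply]
    ring
  rw [hM, Matrix.det_mul, Matrix.det_transpose, Matrix.det_mul_row, gvd]
  ring

/-- For a diagonalizable `A = P diag(λᵢ) P⁻¹` with distinct `λᵢ ∈ [0,1)`,
`qᵢ` the rows of `P⁻¹`, the volume of the infinite-horizon reachable set equals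
`2ⁿ |det P| · |∏_{i<j} (λⱼ-λᵢ)/(1-λᵢλⱼ)| · ∏ᵢ |qᵢ b|/(1-λᵢ)`. -/
theorem stmt8 (n : ℕ) (lam : Fin n → ℝ)
    (hlam : ∀ i, 0 ≤ lam i ∧ lam i < 1) (hdist : Function.Injective lam)
    (P : Matrix (Fin n) (Fin n) ℝ) (hP : IsUnit P.det)
    (A : Matrix (Fin n) (Fin n) ℝ) (hA : A = P * Matrix.diagonal lam * P⁻¹)
    (b : Fin n → ℝ) :
    volume {x : Fin n → ℝ | ∃ u : ℕ → ℝ, (∀ k, |u k| ≤ 1) ∧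
        HasSum (fun k : ℕ => u k • (A ^ k).mulVec b) x} =
    ENNReal.ofReal ((2 : ℝ) ^ n * |P.det| *
      |∏ i : Fin n, ∏ j : Fin n,
        if i < j then (lam j - lam i) / (1 - lam i * lam j) else 1| *
      ∏ i : Fin n, |P⁻¹.mulVec b i| / (1 - lam i)) := by
  refine (vol_reach (fun k => (A ^ k).mulVec b) (|P.det * (∏ i, P⁻¹.mulVec b i)| * |cform lam|) ?_).trans ?_
  · obtain ⟨s, hs, hsf⟩ := gvd_sign lam hdist fun i => (hlam i).1
    have h1 : ∀ N, nestSum n N (fun f => |(Matrix.of (fun j => (A ^ f j).mulVec b)).det|) =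
        |P.det * (∏ i, P⁻¹.mulVec b i)| * |nestSum n N (gvd lam)| := by
      intro N
      simp_rw [stmt8_det lam P A hP hA b, abs_mul (P.det * _)]
      rw [nestSum_const_mul]
      congr 1
      have h2 : nestSum n N (fun f => |gvd lam f|) = s * nestSum n N (gvd lam) := by
        rw [← nestSum_const_mul]
        exact nestSum_congr _ _ _ _ hsf
      rw [← abs_of_nonneg (nestSum_nonneg n N (fun f => |gvd lam f|) fun f => abs_nonneg _), h2,
        abs_mul, hs, one_mul]
    simp_rw [h1]
    exact ((nestSum_tendsto lam hdist hlam).abs).const_mul _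
  · congr 1
    have h1 : |∏ i, (1 / (1 - lam i))| = ∏ i, (1 / (1 - lam i)) := by
      refine abs_of_nonneg (Finset.prod_nonneg fun i _ => ?_)
      have := (hlam i).2
      exact div_nonneg zero_le_one (by linarith)
    rw [cform, abs_mul, abs_mul, h1, Finset.abs_prod (f := fun i => P⁻¹.mulVec b i)]
    have h2 : ∏ i, |P⁻¹.mulVec b i| / (1 - lam i) =
        (∏ i, |P⁻¹.mulVec b i|) * ∏ i, (1 / (1 - lam i)) := by
      rw [← Finset.prod_mul_distrib]
      exact Finset.prod_congr rfl fun i _ => by ring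
    rw [h2]
    ring
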